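/- arXiv:2005.11367 — 2 statements merged into one kernel-verified Lean document; each statement's English description precedes it below -/
import Mathlib

section
/- Let R = ℂ[x,y,z,w] and let λ ∈ ℂ. For every polynomial f ∈ R, setting η := λ·ι(df) ∧ ι(dw) − (x·ι(dy) ∧ ι(dz) − y·ι(dx) ∧ ι(dz) + z·ι(dx) ∧ ι(dy)) in the exterior algebra Λ(Ω_{R/ℂ}), one has η ∧ η = −2λ·(x·∂f/∂x + y·∂f/∂y + z·∂f/∂z) · ι(dx) ∧ ι(dy) ∧ ι(dz) ∧ ι(dw). -/
/-!
STATEMENT 1: In `R = ℂ[x,y,z,w]`, for `λ ∈ ℂ` and every `f ∈ R`, setting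
`η := λ·ι(df)∧ι(dw) − (x·ι(dy)∧ι(dz) − y·ι(dx)∧ι(dz) + z·ι(dx)∧ι(dy))`
in the exterior algebra of `Ω_{R/ℂ}`, one has
`η ∧ η = −2λ·(x·∂f/∂x + y·∂f/∂y + z·∂f/∂z) · ι(dx)∧ι(dy)∧ι(dz)∧ι(dw)`.
-/

noncomputable section

open MvPolynomial

/-- The polynomial ring `R = ℂ[x,y,z,w]`. -/
abbrev R : Type := MvPolynomial (Fin 4) ℂ

/-- The universal derivation `d : R → Ω_{R/ℂ}`. -/
def d : R → Ω[R⁄ℂ] := KaehlerDifferential.D ℂ R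

/-- The canonical linear map `ι : Ω_{R/ℂ} → Λ(Ω_{R/ℂ})`. -/
def ι : Ω[R⁄ℂ] →ₗ[R] ExteriorAlgebra R (Ω[R⁄ℂ]) := ExteriorAlgebra.ι R

/-- The variable `x`. -/
def x : R := MvPolynomial.X 0
/-- The variable `y`. -/
def y : R := MvPolynomial.X 1
/-- The variable `z`. -/
def z : R := MvPolynomial.X 2
/-- The variable `w`. -/
def w : R := MvPolynomial.X 3

/-- The differential of a polynomial expands in the differentials of the variables. -/
theorem KaehlerDifferential.D_eq_sum_pderiv {S σ : Type*} [CommRing S] [Fintype σ]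
    (p : MvPolynomial σ S) :
    KaehlerDifferential.D S (MvPolynomial σ S) p =
      ∑ i, pderiv i p • KaehlerDifferential.D S (MvPolynomial σ S) (X i) := by
  conv_lhs => rw [← (KaehlerDifferential.mvPolynomialBasis S σ).sum_repr
    (KaehlerDifferential.D S (MvPolynomial σ S) p)]
  simp only [KaehlerDifferential.mvPolynomialBasis_repr_apply,
    KaehlerDifferential.mvPolynomialBasis_apply]

/-- The square of `l • u ∧ m₃ - (a • m₁ ∧ m₂ - b • m₀ ∧ m₂ + c • m₀ ∧ m₁)` in an exterior algebra,
where `u` is a linear combination of `m₀, m₁, m₂, m₃`. -/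
theorem ExteriorAlgebra.sq_smul_ι_mul_ι_sub {S M : Type*} [CommRing S] [AddCommGroup M]
    [Module S M] (m₀ m₁ m₂ m₃ : M) (l a b c p q r s : S) :
    let i := ExteriorAlgebra.ι S (M := M)
    let e := l • (i (p • m₀ + q • m₁ + r • m₂ + s • m₃) * i m₃) -
      (a • (i m₁ * i m₂) - b • (i m₀ * i m₂) + c • (i m₀ * i m₁))
    e * e = (-(2 * l * (a * p + b * q + c * r))) • (i m₀ * i m₁ * i m₂ * i m₃) := by
  intro i e
  have sq (m : M) : i m * i m = 0 := ExteriorAlgebra.ι_sq_zero m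
  have sq_left (m : M) (t : ExteriorAlgebra S M) : i m * (i m * t) = 0 := by
    rw [← mul_assoc, sq, zero_mul]
  have swap (m n : M) : i m * i n = -(i n * i m) :=
    eq_neg_of_add_eq_zero_left (ExteriorAlgebra.ι_add_mul_swap m n)
  have swap_left (m n : M) (t : ExteriorAlgebra S M) : i m * (i n * t) = -(i n * (i m * t)) := by
    rw [← mul_assoc, swap, neg_mul, mul_assoc]
  simp only [e, map_add, map_smul, mul_add, add_mul, mul_sub, sub_mul, smul_mul_assoc,
    mul_smul_comm, mul_assoc, sq, sq_left, swap m₂ m₁, swap m₃ m₁, swap m₃ m₂,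
    swap_left m₁ m₀, swap_left m₂ m₀, swap_left m₃ m₀, swap_left m₂ m₁, swap_left m₃ m₁,
    swap_left m₃ m₂, mul_neg, neg_neg, smul_neg, zero_mul, mul_zero, smul_zero,
    neg_zero]
  module

theorem statement1 (lam : ℂ) (f : R)
    (η : ExteriorAlgebra R (Ω[R⁄ℂ]))
    (hη : η = (C lam : R) • (ι (d f) * ι (d w)) -
        (x • (ι (d y) * ι (d z)) - y • (ι (d x) * ι (d z)) + z • (ι (d x) * ι (d y)))) :
    η * η
      = (-(2 * (C lam : R) *
            (x * pderiv (0 : Fin 4) f + y * pderiv (1 : Fin 4) f + z * pderiv (2 : Fin 4) f))) •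
          (ι (d x) * ι (d y) * ι (d z) * ι (d w)) := by
  have hf : d f = pderiv 0 f • d x + pderiv 1 f • d y + pderiv 2 f • d z + pderiv 3 f • d w :=
    (KaehlerDifferential.D_eq_sum_pderiv f).trans (Fin.sum_univ_four _)
  rw [hη, hf]
  exact ExteriorAlgebra.sq_smul_ι_mul_ι_sub (d x) (d y) (d z) (d w) (C lam) x y z _ _ _ _
end
end

section
/- Let R = ℂ[x,y,z,w], let τ, λ ∈ ℂ, and let f = x³ + y³ + z³ + τ·x·y·z ∈ R. Setting η := λ·ι(df) ∧ ι(dw) − (x·ι(dy) ∧ ι(dz) − y·ι(dx) ∧ ι(dz) + z·ι(dx) ∧ ι(dy)) in the exterior algebra Λ(Ω_{R/ℂ}), one has η ∧ η = −6λ·f · ι(dx) ∧ ι(dy) ∧ ι(dz) ∧ ι(dw). In particular, η ∧ η is a nonzero multiple of the volume element exactly where λ·f is nonzero. -/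
/-!
STATEMENT 2: In `R = ℂ[x,y,z,w]`, for `τ, λ ∈ ℂ` and `f = x³ + y³ + z³ + τxyz`, setting
`η := λ·ι(df)∧ι(dw) − (x·ι(dy)∧ι(dz) − y·ι(dx)∧ι(dz) + z·ι(dx)∧ι(dy))`
in the exterior algebra of `Ω_{R/ℂ}`, one has
`η ∧ η = −6λ·f · ι(dx)∧ι(dy)∧ι(dz)∧ι(dw)`.
-/

noncomputable section

open MvPolynomial

section ExteriorAlgebra

variable {S M : Type*} [CommRing S] [AddCommGroup M] [Module S M]

theorem ExteriorAlgebra.ι_mul_ι_swap (a b : M) :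
    ExteriorAlgebra.ι S b * ExteriorAlgebra.ι S a =
      -(ExteriorAlgebra.ι S a * ExteriorAlgebra.ι S b) :=
  eq_neg_of_add_eq_zero_left (ExteriorAlgebra.ι_add_mul_swap b a)

theorem ExteriorAlgebra.ι_mul_ι_mul_swap (a b : M) (t : ExteriorAlgebra S M) :
    ExteriorAlgebra.ι S b * (ExteriorAlgebra.ι S a * t) =
      -(ExteriorAlgebra.ι S a * (ExteriorAlgebra.ι S b * t)) := by
  rw [← mul_assoc, ExteriorAlgebra.ι_mul_ι_swap a b, neg_mul, mul_assoc]

theorem ExteriorAlgebra.ι_mul_ι_mul_self (a : M) (t : ExteriorAlgebra S M) :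
    ExteriorAlgebra.ι S a * (ExteriorAlgebra.ι S a * t) = 0 := by
  rw [← mul_assoc, ExteriorAlgebra.ι_sq_zero, zero_mul]

/-- The square of `l · α ∧ e - β`, where `α = p a + q b + r c` and `β` is the contraction of
`a ∧ b ∧ c` with the vector of coordinates `(u, v, t)`. -/
theorem ExteriorAlgebra.smul_wedge_sub_contraction_mul_self (a b c e : M) (l p q r u v t : S) :
    let j := ExteriorAlgebra.ι S (M := M)
    let η := l • (j (p • a + q • b + r • c) * j e) -
      (u • (j b * j c) - v • (j a * j c) + t • (j a * j b))
    η * η = (-(2 * l * (p * u + q * v + r * t))) • (j a * j b * j c * j e) := by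
  simp only [map_add, map_smul, mul_add, add_mul, mul_sub, sub_mul, smul_mul_assoc,
    mul_smul_comm, mul_assoc, smul_add, smul_sub,
    ι_mul_ι_swap b c, ι_mul_ι_swap b e,
    ι_mul_ι_swap c e, ι_mul_ι_mul_swap a b, ι_mul_ι_mul_swap a c, ι_mul_ι_mul_swap a e,
    ι_mul_ι_mul_swap b c, ι_mul_ι_mul_swap b e, ι_mul_ι_mul_swap c e,
    ι_mul_ι_mul_self, ι_sq_zero, mul_neg, neg_neg, mul_zero, smul_zero, neg_zero, smul_neg]
  module

end ExteriorAlgebra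

theorem d_cubic (τ : ℂ) :
    d (x ^ 3 + y ^ 3 + z ^ 3 + (C τ : R) * x * y * z) =
      (3 * x ^ 2 + C τ * y * z) • d x + (3 * y ^ 2 + C τ * x * z) • d y +
        (3 * z ^ 2 + C τ * x * y) • d z := by
  have hC : KaehlerDifferential.D ℂ R (C τ) = 0 :=
    (KaehlerDifferential.D ℂ R).map_algebraMap τ
  simp only [d, map_add, Derivation.leibniz, Derivation.leibniz_pow, hC]
  module

theorem statement2 (τ lam : ℂ) (f : R)
    (hf : f = x ^ 3 + y ^ 3 + z ^ 3 + (C τ : R) * x * y * z)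
    (η : ExteriorAlgebra R (Ω[R⁄ℂ]))
    (hη : η = (C lam : R) • (ι (d f) * ι (d w)) -
        (x • (ι (d y) * ι (d z)) - y • (ι (d x) * ι (d z)) + z • (ι (d x) * ι (d y)))) :
    η * η = (-(6 * (C lam : R) * f)) • (ι (d x) * ι (d y) * ι (d z) * ι (d w)) := by
  subst hf hη
  have hη := ExteriorAlgebra.smul_wedge_sub_contraction_mul_self
    (d x) (d y) (d z) (d w) (C lam) (3 * x ^ 2 + C τ * y * z) (3 * y ^ 2 + C τ * x * z)
    (3 * z ^ 2 + C τ * x * y) x y z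
  have hcoeff : -(2 * C lam * ((3 * x ^ 2 + C τ * y * z) * x + (3 * y ^ 2 + C τ * x * z) * y +
      (3 * z ^ 2 + C τ * x * y) * z)) =
      -(6 * (C lam : R) * (x ^ 3 + y ^ 3 + z ^ 3 + C τ * x * y * z)) := by
    ring
  rw [← d_cubic, hcoeff] at hη
  exact hη
end
end
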